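/- arXiv:1612.06491 — 2 statements merged into one kernel-verified Lean document; each statement's English description precedes it below -/
import Mathlib

section
/- Let S be a ℂ-linear subspace of the d×d complex matrices that has no shrunk subspace. Then for every n ≥ 1, (1/2)·dⁿ ≤ mrk(S^{⊗n}) ≤ dⁿ. Consequently lim_{n→∞} (mrk(S^{⊗n}))^{1/n} = d. -/
open Matrix

noncomputable def mrk {m n : Type*} [Fintype m] [Fintype n]
    (S : Submodule ℂ (Matrix m n ℂ)) : ℕ :=
  sSup (Matrix.rank '' (S : Set (Matrix m n ℂ)))

noncomputable def tensorSpace {m₁ n₁ m₂ n₂ : Type*}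
    (S : Submodule ℂ (Matrix m₁ n₁ ℂ)) (T : Submodule ℂ (Matrix m₂ n₂ ℂ)) :
    Submodule ℂ (Matrix (m₁ × m₂) (n₁ × n₂) ℂ) :=
  Submodule.span ℂ {M | ∃ A ∈ S, ∃ B ∈ T, M = Matrix.kroneckerMap (· * ·) A B}

noncomputable def tensorPow {d : ℕ} (S : Submodule ℂ (Matrix (Fin d) (Fin d) ℂ)) (n : ℕ) :
    Submodule ℂ (Matrix (Fin n → Fin d) (Fin n → Fin d) ℂ) :=
  Submodule.span ℂ {M | ∃ A : Fin n → Matrix (Fin d) (Fin d) ℂ,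
    (∀ k, A k ∈ S) ∧ M = fun i j => ∏ k, A k (i k) (j k)}

noncomputable def spaceImageOf {ι κ : Type*} [Fintype κ]
    (S : Submodule ℂ (Matrix ι κ ℂ)) (U : Submodule ℂ (κ → ℂ)) : Submodule ℂ (ι → ℂ) :=
  Submodule.span ℂ {v | ∃ A ∈ S, ∃ u ∈ U, v = A.mulVec u}

def HasShrunkSubspace {ι : Type*} [Fintype ι]
    (S : Submodule ℂ (Matrix ι ι ℂ)) : Prop :=
  ∃ U : Submodule ℂ (ι → ℂ),
    Module.finrank ℂ (spaceImageOf S U) < Module.finrank ℂ U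

noncomputable def compSpace (p q m n : ℕ) : Submodule ℂ (Matrix (Fin m) (Fin n) ℂ) where
  carrier := {A | ∀ (i : Fin m) (j : Fin n), p ≤ (i : ℕ) → q ≤ (j : ℕ) → A i j = 0}
  add_mem' := by
    intro a b ha hb i j hi hj
    simp only [Matrix.add_apply, ha i j hi hj, hb i j hi hj, add_zero]
  zero_mem' := by intro i j _ _; rfl
  smul_mem' := by
    intro c a ha i j hi hj
    simp only [Matrix.smul_apply, ha i j hi hj, smul_zero]

/-- A family of endomorphisms is non-shrinking if the joint image of any subspace has at least the
dimension of that subspace. -/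
def NonShrinking {K V σ : Type*} [Field K] [AddCommGroup V] [Module K V]
    (f : σ → V →ₗ[K] V) : Prop :=
  ∀ U : Submodule K V,
    Module.finrank K U ≤ Module.finrank K (⨆ a, U.map (f a) : Submodule K V)

section NonShrinking

variable {K V W σ τ : Type*} [Field K] [AddCommGroup V] [Module K V] [AddCommGroup W] [Module K W]

theorem finrank_eq_finrank_map_fst_add_finrank_comap_inr [FiniteDimensional K V]
    [FiniteDimensional K W] (U : Submodule K (V × W)) :
    Module.finrank K U = Module.finrank K (U.map (LinearMap.fst K V W)) +
      Module.finrank K (U.comap (LinearMap.inr K V W)) := by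
  have h := LinearMap.finrank_range_add_finrank_ker ((LinearMap.fst K V W).domRestrict U)
  rw [LinearMap.range_domRestrict, LinearMap.ker_domRestrict] at h
  rw [← h, ← Submodule.finrank_map_subtype_eq U, Submodule.map_comap_subtype,
    inf_comm, ← LinearMap.range_inr, ← Submodule.map_comap_eq,
    (Submodule.equivMapOfInjective (LinearMap.inr K V W) LinearMap.inr_injective _).finrank_eq]

theorem NonShrinking.prodMap [FiniteDimensional K V] [FiniteDimensional K W]
    {f : σ → V →ₗ[K] V} {g : σ → W →ₗ[K] W} (hf : NonShrinking f) (hg : NonShrinking g) :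
    NonShrinking fun a => (f a).prodMap (g a) := by
  intro U
  rw [finrank_eq_finrank_map_fst_add_finrank_comap_inr U,
    finrank_eq_finrank_map_fst_add_finrank_comap_inr (⨆ a, U.map ((f a).prodMap (g a)))]
  refine add_le_add ((hf _).trans (Submodule.finrank_mono ?_))
    ((hg _).trans (Submodule.finrank_mono ?_))
  · rw [Submodule.map_iSup]
    refine iSup_mono fun a => ?_
    rintro _ ⟨_, ⟨u, hu, rfl⟩, rfl⟩
    exact ⟨_, ⟨u, hu, rfl⟩, rfl⟩
  · refine iSup_le fun a => ?_
    rintro _ ⟨w, hw, rfl⟩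
    refine Submodule.mem_iSup_of_mem a ⟨_, hw, ?_⟩
    simp

theorem NonShrinking.conj {f : σ → V →ₗ[K] V} {g : σ → W →ₗ[K] W} (hf : NonShrinking f)
    (e : V ≃ₗ[K] W) (h : ∀ a v, g a (e v) = e (f a v)) : NonShrinking g := by
  intro U
  have hfg : ∀ a, f a ∘ₗ e.symm.toLinearMap = e.symm.toLinearMap ∘ₗ g a := fun a => by
    ext w
    apply e.injective
    simp [← h]
  have hmap : ⨆ a, (U.map e.symm.toLinearMap).map (f a) =
      (⨆ a, U.map (g a)).map e.symm.toLinearMap := by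
    simp_rw [Submodule.map_iSup, ← Submodule.map_comp, hfg]
  have hle := hf (U.map e.symm.toLinearMap)
  rwa [hmap, LinearEquiv.finrank_map_eq, LinearEquiv.finrank_map_eq] at hle

theorem NonShrinking.comp [FiniteDimensional K V] {f : σ → V →ₗ[K] V} {g : τ → V →ₗ[K] V}
    (hf : NonShrinking f) (hg : NonShrinking g) :
    NonShrinking fun p : σ × τ => f p.1 ∘ₗ g p.2 := by
  intro U
  refine (hg U).trans ((hf _).trans (Submodule.finrank_mono (le_of_eq ?_)))
  simp_rw [Submodule.map_iSup, ← Submodule.map_comp, iSup_prod]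

theorem nonShrinking_of_subsingleton [Subsingleton V] (f : σ → V →ₗ[K] V) : NonShrinking f :=
  fun U => by rw [Subsingleton.elim U ⊥, finrank_bot]; exact Nat.zero_le _

theorem nonShrinking_of_eq_id [FiniteDimensional K V] {f : σ → V →ₗ[K] V} (a : σ)
    (ha : f a = LinearMap.id) : NonShrinking f :=
  fun U => Submodule.finrank_mono (le_iSup_of_le a (by rw [ha, Submodule.map_id]))

theorem NonShrinking.compLeft [FiniteDimensional K V] {f : σ → V →ₗ[K] V} (hf : NonShrinking f)
    (ι : Type*) [Finite ι] : NonShrinking fun a => (f a).compLeft ι := by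
  induction ι using Finite.induction_empty_option with
  | of_equiv e ih => exact ih.conj (LinearEquiv.funCongrLeft K V e.symm) fun a v => rfl
  | h_empty => exact nonShrinking_of_subsingleton _
  | h_option ih =>
    exact (hf.prodMap ih).conj (LinearEquiv.piOptionEquivProd K (M := fun _ => V)).symm fun a v => by
      ext o; cases o <;> rfl

end NonShrinking

section Kronecker

variable {K σ τ κ μ : Type*} [Field K] [Fintype κ] [Fintype μ]

theorem NonShrinking.one_kronecker [DecidableEq κ] {B : τ → Matrix μ μ K}
    (hB : NonShrinking fun b => (B b).mulVecLin) :
    NonShrinking fun b => (Matrix.kroneckerMap (· * ·) (1 : Matrix κ κ K) (B b)).mulVecLin := by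
  refine (hB.compLeft κ).conj (LinearEquiv.curry K K κ μ).symm fun b v => ?_
  ext ⟨i, j⟩
  simp [Matrix.mulVec, dotProduct, Fintype.sum_prod_type_right, Matrix.one_apply]

theorem NonShrinking.kronecker_one [DecidableEq μ] {A : σ → Matrix κ κ K}
    (hA : NonShrinking fun a => (A a).mulVecLin) :
    NonShrinking fun a => (Matrix.kroneckerMap (· * ·) (A a) (1 : Matrix μ μ K)).mulVecLin := by
  refine (hA.one_kronecker (κ := μ)).conj
    (LinearEquiv.funCongrLeft K K (Equiv.prodComm κ μ)) fun a v => ?_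
  ext ⟨i, j⟩
  simp [Matrix.mulVec, dotProduct, Fintype.sum_prod_type, Matrix.one_apply, LinearEquiv.funCongrLeft,
    LinearMap.funLeft]

theorem NonShrinking.kronecker {A : σ → Matrix κ κ K} {B : τ → Matrix μ μ K}
    (hA : NonShrinking fun a => (A a).mulVecLin) (hB : NonShrinking fun b => (B b).mulVecLin) :
    NonShrinking fun p : σ × τ =>
      (Matrix.kroneckerMap (· * ·) (A p.1) (B p.2)).mulVecLin := by
  classical
  have h := (hA.kronecker_one (μ := μ)).comp (hB.one_kronecker (κ := κ))
  simp_rw [← Matrix.mulVecLin_mul, ← Matrix.mul_kronecker_mul, mul_one, one_mul] at h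
  exact h

theorem NonShrinking.piProd {A : σ → Matrix κ κ K} (hA : NonShrinking fun a => (A a).mulVecLin)
    (n : ℕ) :
    NonShrinking fun s : Fin n → σ => Matrix.mulVecLin
      (Matrix.of fun i j : Fin n → κ => ∏ k, A (s k) (i k) (j k)) := by
  induction n with
  | zero =>
    refine nonShrinking_of_eq_id ![] ?_
    ext v i
    simp [Matrix.mulVec, dotProduct, Subsingleton.elim v default, Subsingleton.elim i default]
  | succ n ih =>
    intro U
    have h := (hA.kronecker ih).conj (g := fun p : σ × (Fin n → σ) => Matrix.mulVecLin
      (Matrix.of fun i j : Fin (n + 1) → κ =>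
        ∏ k, A ((Fin.cons p.1 p.2 : Fin (n + 1) → σ) k) (i k) (j k)))
      (LinearEquiv.funCongrLeft K K (Fin.consEquiv fun _ => κ).symm) ?_
    · refine (h U).trans (Submodule.finrank_mono (iSup_le fun p => ?_))
      exact le_iSup_of_le (Fin.cons p.1 p.2) le_rfl
    · intro p v
      ext i
      simp only [Matrix.mulVecLin_apply, Matrix.mulVec, dotProduct, LinearEquiv.funCongrLeft_apply,
        LinearMap.funLeft_apply]
      rw [← (Fin.consEquiv fun _ => κ).sum_comp]
      simp [Fin.prod_univ_succ, Fin.consEquiv, Fin.tail]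

end Kronecker

section Rank

open Filter Topology

theorem rank_lt_rank_add_smul {κ : Type*} [Fintype κ] {A B : Matrix κ κ ℂ} {x : κ → ℂ}
    (hx : A *ᵥ x = 0) (hBx : B *ᵥ x ∉ A.mulVecLin.range) :
    ∃ t : ℂ, A.rank < (A + t • B).rank := by
  let b : Module.Basis (Fin A.rank) ℂ A.mulVecLin.range := Module.finBasis ℂ A.mulVecLin.range
  choose v hv using fun i => (b i).2
  let F : ℂ → Option (Fin A.rank) → κ → ℂ :=
    fun t o => o.elim (B *ᵥ x) fun i => (A + t • B) *ᵥ v i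
  have hF : Continuous F := by
    refine continuous_pi fun o => ?_
    cases o with
    | none => exact continuous_const
    | some i =>
      simp only [F, Option.elim, Matrix.add_mulVec, Matrix.smul_mulVec]
      fun_prop
  have h0 : LinearIndependent ℂ (F 0) := by
    have hb : F 0 ∘ some = A.mulVecLin.range.subtype ∘ b := by
      ext1 i
      simpa only [F, Function.comp_apply, Option.elim, zero_smul, add_zero] using! hv i
    rw [linearIndependent_option, hb, Set.range_comp, Submodule.span_image, b.span_eq,
      Submodule.map_top, Submodule.range_subtype]
    exact ⟨b.linearIndependent.map' _ (Submodule.ker_subtype _), hBx⟩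
  have hev : ∀ᶠ t in 𝓝[≠] (0 : ℂ), LinearIndependent ℂ (F t) :=
    (hF.tendsto 0).eventually (isOpen_setOfPred_linearIndependent.mem_nhds h0) |>.filter_mono
      nhdsWithin_le_nhds
  obtain ⟨t, ht, ht0⟩ := (hev.and self_mem_nhdsWithin).exists
  refine ⟨t, ?_⟩
  have hmem : ∀ o, F t o ∈ (A + t • B).mulVecLin.range := by
    rintro (_ | i)
    · refine ⟨t⁻¹ • x, ?_⟩
      have ht0 : t ≠ 0 := ht0
      simp [F, Matrix.add_mulVec, Matrix.smul_mulVec, hx, smul_smul, ht0]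
    · exact ⟨v i, rfl⟩
  have hli : LinearIndependent ℂ
      fun o => (⟨F t o, hmem o⟩ : LinearMap.range (A + t • B).mulVecLin) :=
    .of_comp (Submodule.subtype _) ht
  have hcard := hli.fintype_card_le_finrank
  rw [Fintype.card_option, Fintype.card_fin] at hcard
  exact hcard

variable {κ : Type*} [Fintype κ]

theorem card_mem_upperBounds_rank (T : Submodule ℂ (Matrix κ κ ℂ)) :
    Fintype.card κ ∈ upperBounds (Matrix.rank '' (T : Set (Matrix κ κ ℂ))) := by
  rintro _ ⟨A, -, rfl⟩
  exact A.rank_le_card_width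

theorem mrk_le_card (T : Submodule ℂ (Matrix κ κ ℂ)) : mrk T ≤ Fintype.card κ :=
  csSup_le' (card_mem_upperBounds_rank T)

theorem rank_le_mrk {T : Submodule ℂ (Matrix κ κ ℂ)} {A : Matrix κ κ ℂ} (hA : A ∈ T) :
    A.rank ≤ mrk T :=
  le_csSup ⟨_, card_mem_upperBounds_rank T⟩ ⟨A, hA, rfl⟩

theorem exists_rank_eq_mrk (T : Submodule ℂ (Matrix κ κ ℂ)) : ∃ A ∈ T, A.rank = mrk T :=
  Nat.sSup_mem (s := Matrix.rank '' (T : Set (Matrix κ κ ℂ))) ⟨_, 0, T.zero_mem, rfl⟩ ⟨_, card_mem_upperBounds_rank T⟩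

theorem NonShrinking.card_le_two_mul_mrk {σ : Type*} {B : σ → Matrix κ κ ℂ}
    (hB : NonShrinking fun a => (B a).mulVecLin) {T : Submodule ℂ (Matrix κ κ ℂ)}
    (hT : ∀ a, B a ∈ T) : Fintype.card κ ≤ 2 * mrk T := by
  obtain ⟨A, hA, hAr⟩ := exists_rank_eq_mrk T
  have hle : (⨆ a, A.mulVecLin.ker.map (B a).mulVecLin) ≤ A.mulVecLin.range := by
    refine iSup_le fun a => ?_
    rintro _ ⟨x, hx, rfl⟩
    by_contra hBx
    obtain ⟨t, ht⟩ := rank_lt_rank_add_smul hx hBx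
    exact (ht.trans_le (rank_le_mrk (T.add_mem hA (T.smul_mem t (hT a))))).ne hAr
  have h := (hB A.mulVecLin.ker).trans (Submodule.finrank_mono hle)
  have hrn := LinearMap.finrank_range_add_finrank_ker A.mulVecLin
  rw [Module.finrank_fintype_fun_eq_card] at hrn
  change Module.finrank ℂ A.mulVecLin.range = _ at hAr
  omega

end Rank

theorem nonShrinking_of_not_hasShrunkSubspace {κ : Type*} [Fintype κ]
    {S : Submodule ℂ (Matrix κ κ ℂ)} (h : ¬ HasShrunkSubspace S) :
    NonShrinking fun A : S => (A : Matrix κ κ ℂ).mulVecLin := by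
  intro U
  refine (not_lt.1 fun hlt => h ⟨U, hlt⟩ :
    Module.finrank ℂ U ≤ Module.finrank ℂ (spaceImageOf S U)).trans (Submodule.finrank_mono ?_)
  refine Submodule.span_le.2 ?_
  rintro _ ⟨A, hA, u, hu, rfl⟩
  exact Submodule.mem_iSup_of_mem ⟨A, hA⟩ ⟨u, hu, rfl⟩

theorem tendsto_rpow_inv_of_half_pow_le {d : ℕ} {a : ℕ → ℕ}
    (h : ∀ n : ℕ, 1 ≤ n → ((d : ℝ) ^ n) / 2 ≤ (a n : ℝ) ∧ (a n : ℝ) ≤ (d : ℝ) ^ n) :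
    Filter.Tendsto (fun n : ℕ => (a n : ℝ) ^ ((n : ℝ)⁻¹)) Filter.atTop (nhds (d : ℝ)) := by
  have hinv : Filter.Tendsto (fun n : ℕ => (d : ℝ) * (1 / 2 : ℝ) ^ ((n : ℝ)⁻¹)) Filter.atTop
      (nhds (d : ℝ)) := by
    have h1 := (Real.continuousAt_const_rpow (a := 1 / 2) (b := 0) (by norm_num)).tendsto.comp
      (tendsto_inv_atTop_nhds_zero_nat (𝕜 := ℝ))
    simpa [Function.comp_def] using h1.const_mul (d : ℝ)
  refine tendsto_of_tendsto_of_tendsto_of_le_of_le' hinv tendsto_const_nhds ?_ ?_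
  all_goals
    filter_upwards [Filter.eventually_ge_atTop 1] with n hn
    have hd : ((d : ℝ) ^ n) ^ ((n : ℝ)⁻¹) = d :=
      Real.pow_rpow_inv_natCast (Nat.cast_nonneg d) (by omega)
    obtain ⟨hl, hu⟩ := h n hn
  · calc (d : ℝ) * (1 / 2 : ℝ) ^ ((n : ℝ)⁻¹) = ((d : ℝ) ^ n / 2) ^ ((n : ℝ)⁻¹) := by
          rw [div_eq_mul_one_div ((d : ℝ) ^ n), Real.mul_rpow (by positivity) (by norm_num), hd]
      _ ≤ _ := Real.rpow_le_rpow (by positivity) hl (by positivity)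
  · exact (Real.rpow_le_rpow (by positivity) hu (by positivity)).trans_eq hd

theorem stmt9 {d : ℕ} (S : Submodule ℂ (Matrix (Fin d) (Fin d) ℂ))
    (h : ¬ HasShrunkSubspace S) :
    (∀ n : ℕ, 1 ≤ n →
      ((d : ℝ) ^ n) / 2 ≤ (mrk (tensorPow S n) : ℝ) ∧
      (mrk (tensorPow S n) : ℝ) ≤ (d : ℝ) ^ n) ∧
    Filter.Tendsto (fun n : ℕ => (mrk (tensorPow S n) : ℝ) ^ ((n : ℝ)⁻¹))
      Filter.atTop (nhds (d : ℝ)) := by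
  have hbound : ∀ n : ℕ, 1 ≤ n →
      ((d : ℝ) ^ n) / 2 ≤ (mrk (tensorPow S n) : ℝ) ∧
      (mrk (tensorPow S n) : ℝ) ≤ (d : ℝ) ^ n := by
    intro n _
    have hcard : Fintype.card (Fin n → Fin d) = d ^ n := by simp
    have hlow := ((nonShrinking_of_not_hasShrunkSubspace h).piProd n).card_le_two_mul_mrk
      (T := tensorPow S n) fun s => Submodule.subset_span ⟨fun k => s k, fun k => (s k).2, rfl⟩
    have hup := mrk_le_card (tensorPow S n)
    rw [hcard] at hlow hup
    refine ⟨?_, by exact_mod_cast hup⟩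
    rw [div_le_iff₀' two_pos]
    exact_mod_cast hlow
  exact ⟨hbound, tendsto_rpow_inv_of_half_pow_le hbound⟩
end

section
/- Let p, q, d be natural numbers with p ≥ 1, q ≥ 1 and p+q < d, and let N ≥ 0 be an integer. Then the maximal rank of the (N+1)-st tensor power of A(p,q,d) satisfies mrk(A(p,q,d)^{⊗(N+1)}) = Σ_{k=0}^{N} C(N,k) · ( min{p^{N−k+1}(d−p)^k, q^k(d−q)^{N−k+1}} + min{q^{k+1}(d−q)^{N−k}, p^{N−k}(d−p)^{k+1}} ), where C(N,k) is the binomial coefficient. -/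
open Matrix

theorem Matrix.rank_add_le_add {K m n : Type*} [Field K] [Finite m] [Fintype n]
    (A B : Matrix m n K) : (A + B).rank ≤ A.rank + B.rank := by
  refine (Submodule.finrank_mono ?_).trans
    (Submodule.finrank_add_le_finrank_add_finrank A.mulVecLin.range B.mulVecLin.range)
  rintro _ ⟨x, rfl⟩
  rw [Matrix.mulVecLin_add]
  exact Submodule.add_mem_sup (LinearMap.mem_range_self _ x) (LinearMap.mem_range_self _ x)

/-- The rank of a matrix is at most the size of a set of lines covering its nonzero entries. -/
theorem Matrix.rank_le_of_cover {K m n : Type*} [Field K] [Fintype m] [Fintype n]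
    (M : Matrix m n K) (R : Finset m) (C : Finset n)
    (h : ∀ i j, i ∉ R → j ∉ C → M i j = 0) : M.rank ≤ R.card + C.card := by
  classical
  let A : Matrix m n K := Matrix.of fun i j => if i ∈ R then M i j else 0
  have hA : A.rank ≤ R.card := by
    refine A.rank_le_card_of_support_subset R fun i hi => ?_
    by_contra hR
    refine hi (funext fun j => ?_)
    exact if_neg (by simpa using hR)
  have hB : (M - A).rank ≤ C.card := by
    rw [← Matrix.rank_transpose]
    refine Matrix.rank_le_card_of_support_subset _ C fun j hj => ?_
    by_contra hC
    refine hj (funext fun i => ?_)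
    by_cases hi : i ∈ R
    · simp [A, hi]
    · simpa [A, hi] using h i j hi (by simpa using hC)
  calc M.rank = (A + (M - A)).rank := by rw [add_sub_cancel]
    _ ≤ R.card + C.card := (Matrix.rank_add_le_add _ _).trans (Nat.add_le_add hA hB)

/-- The sum of the matrix units along a matching has rank at least the size of the matching. -/
theorem Matrix.card_le_rank_sum_single {K m n T : Type*} [Field K] [Fintype m] [Fintype n]
    [DecidableEq m] [DecidableEq n] [Fintype T] {r : T → m} {c : T → n}
    (hr : Function.Injective r) (hc : Function.Injective c) :
    Fintype.card T ≤ (∑ t, Matrix.single (r t) (c t) (1 : K)).rank := by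
  classical
  have h : (∑ t, Matrix.single (r t) (c t) (1 : K)).submatrix r c = 1 := by
    ext s t
    simp only [Matrix.submatrix_apply, Matrix.sum_apply, Matrix.single_apply, hr.eq_iff,
      hc.eq_iff, Matrix.one_apply]
    rw [Finset.sum_eq_single s] <;> simp +contextual
  calc Fintype.card T = (1 : Matrix T T K).rank := Matrix.rank_one.symm
    _ ≤ _ := h ▸ Matrix.rank_submatrix_le _ r c

/-- If the rows and columns are labelled by `τ`, then rows and columns with equal labels
can be matched. -/
theorem exists_matching_of_labels {m n τ : Type*} [Fintype m] [Fintype n] [Fintype τ]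
    [DecidableEq τ] (ρ : m → τ) (γ : n → τ) :
    ∃ (r : (Σ x, Fin (min (Fintype.card {i // ρ i = x}) (Fintype.card {j // γ j = x}))) → m)
      (c : (Σ x, Fin (min (Fintype.card {i // ρ i = x}) (Fintype.card {j // γ j = x}))) → n),
      Function.Injective r ∧ Function.Injective c ∧ ∀ t, ρ (r t) = γ (c t) := by
  let e (x : τ) := (Fintype.equivFin {i // ρ i = x}).symm
  let f (x : τ) := (Fintype.equivFin {j // γ j = x}).symm
  refine ⟨fun t => e t.1 (Fin.castLE (min_le_left _ _) t.2),
    fun t => f t.1 (Fin.castLE (min_le_right _ _) t.2), ?_, ?_, ?_⟩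
  · rintro ⟨x, s⟩ ⟨y, t⟩ h
    obtain rfl : x = y := by
      exact (e x _).2.symm.trans ((congrArg ρ h).trans (e y _).2)
    simpa [Subtype.coe_inj] using h
  · rintro ⟨x, s⟩ ⟨y, t⟩ h
    obtain rfl : x = y := by
      exact (f x _).2.symm.trans ((congrArg γ h).trans (f y _).2)
    simpa [Subtype.coe_inj] using h
  · intro t
    exact (e t.1 _).2.trans (f t.1 _).2.symm

theorem mrk_le {m n : Type*} [Fintype m] [Fintype n] {S : Submodule ℂ (Matrix m n ℂ)} {b : ℕ}
    (h : ∀ M ∈ S, M.rank ≤ b) : mrk S ≤ b :=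
  csSup_le (Set.Nonempty.image _ ⟨0, S.zero_mem⟩) (Set.forall_mem_image.2 h)

theorem rank_le_mrk_s14 {m n : Type*} [Fintype m] [Fintype n] {S : Submodule ℂ (Matrix m n ℂ)}
    {M : Matrix m n ℂ} (hM : M ∈ S) : M.rank ≤ mrk S :=
  le_csSup ⟨Fintype.card n, Set.forall_mem_image.2 fun A _ => A.rank_le_card_width⟩
    (Set.mem_image_of_mem _ hM)

theorem apply_eq_zero_of_mem_tensorPow {p q d n : ℕ} {M : Matrix (Fin n → Fin d) (Fin n → Fin d) ℂ}
    (hM : M ∈ tensorPow (compSpace p q d d) n) {i j : Fin n → Fin d} {k : Fin n}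
    (hi : p ≤ (i k : ℕ)) (hj : q ≤ (j k : ℕ)) : M i j = 0 := by
  induction hM using Submodule.span_induction with
  | mem M h =>
    obtain ⟨A, hA, rfl⟩ := h
    exact Finset.prod_eq_zero (Finset.mem_univ k) (hA k _ _ hi hj)
  | zero => rfl
  | add A B _ _ hA hB => simp [hA, hB]
  | smul a A _ hA => simp [hA]

theorem single_mem_tensorPow {p q d n : ℕ} {i j : Fin n → Fin d}
    (h : ∀ k, (i k : ℕ) < p ∨ (j k : ℕ) < q) :
    Matrix.single i j (1 : ℂ) ∈ tensorPow (compSpace p q d d) n := by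
  refine Submodule.subset_span ⟨fun k => Matrix.single (i k) (j k) 1, fun k a b ha hb => ?_, ?_⟩
  · refine Matrix.single_apply_of_ne _ _ _ _ _ ?_
    rintro ⟨rfl, rfl⟩
    have := h k
    omega
  · ext a b
    simp only [Matrix.single_apply, Finset.prod_boole, funext_iff, Finset.mem_univ, true_imp_iff,
      forall_and]

/-- The set of positions at which a multi-index lies below the threshold `t`. -/
def belowSet {d n : ℕ} (t : ℕ) (i : Fin n → Fin d) : Finset (Fin n) :=
  Finset.univ.filter fun k => (i k : ℕ) < t

theorem card_belowSet_eq {d n t : ℕ} (ht : t ≤ d) (X : Finset (Fin n)) :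
    Fintype.card {i : Fin n → Fin d // belowSet t i = X} =
      t ^ X.card * (d - t) ^ (n - X.card) := by
  classical
  have hlt : (Finset.univ.filter fun a : Fin d => (a : ℕ) < t).card = t := by
    rw [Fin.card_filter_val_lt, min_eq_right ht]
  have hge : (Finset.univ.filter fun a : Fin d => ¬ (a : ℕ) < t).card = d - t := by
    have := Finset.card_filter_add_card_filter_not (s := (Finset.univ : Finset (Fin d)))
      (fun a : Fin d => (a : ℕ) < t)
    rw [Finset.card_fin] at this
    omega
  have hX : (Finset.univ.filter fun i : Fin n → Fin d => belowSet t i = X) =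
      Fintype.piFinset fun k => Finset.univ.filter fun a : Fin d => ((a : ℕ) < t ↔ k ∈ X) := by
    ext i
    simp [belowSet, Finset.ext_iff]
  rw [Fintype.card_subtype, hX, Fintype.card_piFinset]
  have hk : ∀ k, (Finset.univ.filter fun a : Fin d => ((a : ℕ) < t ↔ k ∈ X)).card =
      if k ∈ X then t else d - t := by
    intro k
    split_ifs with h
    · simpa only [h, iff_true] using hlt
    · simpa only [h, iff_false] using hge
  simp only [hk, Finset.prod_ite, Finset.prod_const, Finset.filter_mem_eq_inter,
    Finset.univ_inter, Finset.filter_not, ← Finset.compl_eq_univ_sdiff, Finset.card_compl,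
    Fintype.card_fin]

theorem card_compl_belowSet_eq {d n t : ℕ} (ht : t ≤ d) (X : Finset (Fin n)) :
    Fintype.card {i : Fin n → Fin d // (belowSet t i)ᶜ = X} =
      t ^ (n - X.card) * (d - t) ^ X.card := by
  have hX : X.card ≤ n := by simpa using X.card_le_univ
  simp only [compl_eq_comm (y := X)]
  simp only [eq_comm (a := Xᶜ)]
  rw [card_belowSet_eq ht, Finset.card_compl, Fintype.card_fin, Nat.sub_sub_self hX]

theorem weight_le_of_le {p q d n k l : ℕ} (hpq : p + q < d) (hkl : k ≤ l) (hl : l ≤ n)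
    (h : p ^ (n - l) * (d - p) ^ l ≤ q ^ l * (d - q) ^ (n - l)) :
    p ^ (n - k) * (d - p) ^ k ≤ q ^ k * (d - q) ^ (n - k) := by
  obtain ⟨m, rfl⟩ := Nat.exists_eq_add_of_le hkl
  have hn : n - k = (n - (k + m)) + m := by omega
  have hpos : 0 < (d - p) ^ m * (d - q) ^ m :=
    Nat.mul_pos (Nat.pow_pos (by omega)) (Nat.pow_pos (by omega))
  refine Nat.le_of_mul_le_mul_right ?_ hpos
  generalize n - (k + m) = s at *
  rw [hn]
  calc p ^ (s + m) * (d - p) ^ k * ((d - p) ^ m * (d - q) ^ m)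
      = p ^ s * (d - p) ^ (k + m) * (p ^ m * (d - q) ^ m) := by ring
    _ ≤ q ^ (k + m) * (d - q) ^ s * (p ^ m * (d - q) ^ m) := Nat.mul_le_mul_right _ h
    _ = q ^ k * (d - q) ^ (s + m) * (p ^ m * q ^ m) := by ring
    _ ≤ q ^ k * (d - q) ^ (s + m) * ((d - q) ^ m * (d - p) ^ m) := by
      gcongr <;> omega
    _ = q ^ k * (d - q) ^ (s + m) * ((d - p) ^ m * (d - q) ^ m) := by ring

theorem card_filter_label {m τ : Type*} [Fintype m] [Fintype τ] [DecidableEq τ] (ρ : m → τ)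
    (P : τ → Prop) [DecidablePred P] :
    (Finset.univ.filter fun i => P (ρ i)).card =
      ∑ x, if P x then Fintype.card {i // ρ i = x} else 0 := by
  rw [Finset.card_eq_sum_card_fiberwise (f := ρ) (t := Finset.univ) (fun _ _ => by simp)]
  refine Finset.sum_congr rfl fun x _ => ?_
  rw [Finset.filter_filter, Fintype.card_subtype]
  split_ifs with h
  · congr 1
    ext i
    simp only [Finset.mem_filter, Finset.mem_univ, true_and, and_iff_right_iff_imp]
    rintro rfl
    exact h
  · rw [Finset.card_eq_zero, Finset.filter_eq_empty_iff]
    rintro i - ⟨hi, rfl⟩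
    exact h hi

theorem mrk_tensorPow_compSpace {p q d : ℕ} (hpq : p + q < d) (n : ℕ) :
    mrk (tensorPow (compSpace p q d d) n) = ∑ X : Finset (Fin n),
      min (p ^ (n - X.card) * (d - p) ^ X.card) (q ^ X.card * (d - q) ^ (n - X.card)) := by
  have hp : p ≤ d := by omega
  have hq : q ≤ d := by omega
  let ρ : (Fin n → Fin d) → Finset (Fin n) := fun i => (belowSet p i)ᶜ
  let γ : (Fin n → Fin d) → Finset (Fin n) := belowSet q
  have hρ : ∀ X, Fintype.card {i // ρ i = X} = p ^ (n - X.card) * (d - p) ^ X.card :=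
    card_compl_belowSet_eq hp
  have hγ : ∀ X, Fintype.card {j // γ j = X} = q ^ X.card * (d - q) ^ (n - X.card) :=
    card_belowSet_eq hq
  refine le_antisymm (mrk_le fun M hM => ?_) ?_
  · let P : Finset (Fin n) → Prop := fun X =>
      p ^ (n - X.card) * (d - p) ^ X.card ≤ q ^ X.card * (d - q) ^ (n - X.card)
    refine (M.rank_le_of_cover (Finset.univ.filter fun i => P (ρ i))
      (Finset.univ.filter fun j => ¬ P (γ j)) fun i j hi hj => ?_).trans_eq ?_
    · simp only [Finset.mem_filter, Finset.mem_univ, true_and, not_not] at hi hj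
      have hsub : ¬ ρ i ⊆ γ j := fun hsub => hi <|
        weight_le_of_le hpq (Finset.card_le_card hsub) (by simpa using (γ j).card_le_univ) hj
      obtain ⟨k, hk, hk'⟩ := Finset.not_subset.1 hsub
      simp only [ρ, γ, belowSet, Finset.mem_compl, Finset.mem_filter, Finset.mem_univ, true_and,
        not_lt] at hk hk'
      exact apply_eq_zero_of_mem_tensorPow hM hk hk'
    · rw [card_filter_label ρ P, card_filter_label γ (fun X => ¬ P X), ← Finset.sum_add_distrib]
      refine Finset.sum_congr rfl fun X _ => ?_
      rw [hρ, hγ]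
      by_cases h : P X
      · simp only [h, not_true, if_true, if_false, add_zero]
        exact (min_eq_left h).symm
      · simp only [h, not_false_iff, if_true, if_false, zero_add]
        exact (min_eq_right (le_of_not_ge h)).symm
  · obtain ⟨r, c, hr, hc, hrc⟩ := exists_matching_of_labels ρ γ
    have hcard := Matrix.card_le_rank_sum_single (K := ℂ) hr hc
    simp only [Fintype.card_sigma, Fintype.card_fin, hρ, hγ] at hcard
    refine hcard.trans (rank_le_mrk_s14 (Submodule.sum_mem _ fun t _ => single_mem_tensorPow
      fun k => ?_))
    have hk := Finset.ext_iff.1 (hrc t) k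
    simp only [ρ, γ, belowSet, Finset.mem_compl, Finset.mem_filter, Finset.mem_univ,
      true_and] at hk
    tauto

theorem stmt14 {p q d : ℕ} (hp : 1 ≤ p) (hq : 1 ≤ q) (hpq : p + q < d) (N : ℕ) :
    mrk (tensorPow (compSpace p q d d) (N + 1)) =
      ∑ k ∈ Finset.range (N + 1), Nat.choose N k *
        (min (p ^ (N - k + 1) * (d - p) ^ k) (q ^ k * (d - q) ^ (N - k + 1)) +
         min (q ^ (k + 1) * (d - q) ^ (N - k)) (p ^ (N - k) * (d - p) ^ (k + 1))) := by
  have hsum := Finset.sum_powerset_apply_card (x := (Finset.univ : Finset (Fin (N + 1))))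
    fun k => min (p ^ (N + 1 - k) * (d - p) ^ k) (q ^ k * (d - q) ^ (N + 1 - k))
  have hpascal := Finset.sum_choose_succ_mul
    (fun i j => min (p ^ j * (d - p) ^ i) (q ^ i * (d - q) ^ j)) N
  rw [Finset.powerset_univ, Finset.card_fin] at hsum
  simp only [Nat.cast_id] at hpascal
  simp only [smul_eq_mul] at hsum
  rw [mrk_tensorPow_compSpace hpq, hsum, hpascal, ← Finset.sum_add_distrib]
  refine Finset.sum_congr rfl fun k hk => ?_
  have hk' : N + 1 - k = N - k + 1 := Nat.succ_sub (Finset.mem_range_succ_iff.1 hk)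
  rw [hk', mul_add, min_comm (q ^ (k + 1) * _)]
end
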